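/- arXiv:0706.1497 — 2 statements merged into one kernel-verified Lean document; each statement's English description precedes it below -/
import Mathlib

section
/- Let f ∈ Z[x] be a polynomial of degree at most k with no factor repeated k times, such that for every prime p the congruence f(x) ≡ 0 (mod p^k) has a non-solution in Z/p^kZ. Then there are infinitely many integers n such that f(n) is free of k-th powers. -/
open Polynomial

theorem clear_den (P : ℚ[X]) : ∃ c : ℤ, c ≠ 0 ∧ ∃ g : ℤ[X],
    g.map (Int.castRingHom ℚ) = C (c : ℚ) * P := by
  obtain ⟨c, hc, h⟩ := IsLocalization.integerNormalization_spec (nonZeroDivisors ℤ) P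
  refine ⟨c, nonZeroDivisors.ne_zero hc,
    IsLocalization.integerNormalization (nonZeroDivisors ℤ) P, ?_⟩
  rw [Algebra.smul_def] at h
  simpa using h

theorem dvd_rad_pow (k : ℕ) (hk : 2 ≤ k) (f : ℤ[X])
    (hf : f ≠ 0) (hnokth : ∀ g : ℤ[X], g ^ k ∣ f → IsUnit g) :
    f.map (Int.castRingHom ℚ) ∣
      (UniqueFactorizationMonoid.radical (f.map (Int.castRingHom ℚ))) ^ (k - 1) := by
  classical
  set F := f.map (Int.castRingHom ℚ) with hF
  have hF0 : F ≠ 0 := (Polynomial.map_ne_zero_iff Int.cast_injective).2 hf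
  rw [UniqueFactorizationMonoid.dvd_iff_normalizedFactors_le_normalizedFactors hF0
    (pow_ne_zero _ UniqueFactorizationMonoid.radical_ne_zero), UniqueFactorizationMonoid.normalizedFactors_pow,
    Multiset.le_iff_count]
  intro q
  rw [Multiset.count_nsmul]
  by_cases hq : q ∈ UniqueFactorizationMonoid.normalizedFactors F
  · have hirr := UniqueFactorizationMonoid.irreducible_of_normalized_factor q hq
    have hnorm := UniqueFactorizationMonoid.normalize_normalized_factor q hq
    have h1 : q ∈ UniqueFactorizationMonoid.normalizedFactors
        (UniqueFactorizationMonoid.radical F) := by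
      rw [← UniqueFactorizationMonoid.mem_primeFactors,
        UniqueFactorizationMonoid.primeFactors_radical,
        UniqueFactorizationMonoid.mem_primeFactors]
      exact hq
    have h2 : 1 ≤ Multiset.count q (UniqueFactorizationMonoid.normalizedFactors
        (UniqueFactorizationMonoid.radical F)) := Multiset.one_le_count_iff_mem.2 h1
    have h3 : Multiset.count q (UniqueFactorizationMonoid.normalizedFactors F) < k := by
      by_contra! hcon
      have hdvd : q ^ k ∣ F := by
        have h4 : Multiset.replicate k q ≤ UniqueFactorizationMonoid.normalizedFactors F :=
          Multiset.le_count_iff_replicate_le.1 hcon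
        have h5 := Multiset.prod_dvd_prod_of_le h4
        rw [Multiset.prod_replicate] at h5
        exact h5.trans (UniqueFactorizationMonoid.prod_normalizedFactors hF0).dvd
      obtain ⟨c, hc, g, hg⟩ := clear_den q
      have hg0 : g ≠ 0 := by
        rintro rfl
        simp [hc, hirr.ne_zero] at hg
      have hprim := g.isPrimitive_primPart
      have hass : Associated (g.primPart.map (Int.castRingHom ℚ)) q := by
        have e := congrArg (Polynomial.map (Int.castRingHom ℚ)) g.eq_C_content_mul_primPart
        rw [hg, Polynomial.map_mul, Polynomial.map_C] at e
        have u1 : IsUnit (C (c : ℚ)) := Polynomial.isUnit_C.2 (by simp [hc])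
        have u2 : IsUnit (C ((Int.castRingHom ℚ) g.content)) :=
          Polynomial.isUnit_C.2 (by simp [Polynomial.content_eq_zero_iff, hg0])
        refine (associated_unit_mul_left _ _ u2).symm.trans ?_
        rw [← e]
        exact associated_unit_mul_left _ _ u1
      have hd2 : g.primPart ^ k ∣ f := by
        have hp : (g.primPart ^ k).IsPrimitive := by
          have : ∀ m : ℕ, (g.primPart ^ m).IsPrimitive := by
            intro m
            induction m with
            | zero => simp
            | succ m ih => rw [pow_succ]; exact ih.mul hprim
          exact this k
        rw [IsPrimitive.Int.dvd_iff_map_cast_dvd_map_cast _ _ hp, Polynomial.map_pow]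
        exact (hass.pow_pow).dvd.trans hdvd
      have hu := hnokth _ hd2
      have hu2 : IsUnit (g.primPart.map (Int.castRingHom ℚ)) :=
        hu.map (Polynomial.mapRingHom (Int.castRingHom ℚ))
      exact hirr.not_isUnit (hass.isUnit hu2)
    calc _ ≤ (k-1) * 1 := by omega
      _ ≤ _ := Nat.mul_le_mul_left _ h2
  · rw [Multiset.count_eq_zero_of_notMem hq]; exact Nat.zero_le _

theorem alg_part (k : ℕ) (hk : 2 ≤ k) (f : ℤ[X])
    (hf : f ≠ 0) (hnokth : ∀ g : ℤ[X], g ^ k ∣ f → IsUnit g) :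
    ∃ (g a b h : ℤ[X]) (r c : ℤ), r ≠ 0 ∧ c ≠ 0 ∧ a * g + b * derivative g = C r ∧
      C c * g ^ (k - 1) = f * h := by
  have hd := dvd_rad_pow k hk f hf hnokth
  set R := UniqueFactorizationMonoid.radical (f.map (Int.castRingHom ℚ)) with hR
  have hsep : R.Separable := PerfectField.separable_iff_squarefree.2
    UniqueFactorizationMonoid.squarefree_radical
  obtain ⟨A, B, hAB⟩ := hsep
  obtain ⟨H, hH⟩ := hd
  obtain ⟨m, hm, g, hg⟩ := clear_den R
  obtain ⟨ma, hma, a, ha⟩ := clear_den A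
  obtain ⟨mb, hmb, b, hb⟩ := clear_den B
  obtain ⟨mh, hmh, h, hh⟩ := clear_den H
  have inj : Function.Injective (Polynomial.map (Int.castRingHom ℚ)) :=
    Polynomial.map_injective _ Int.cast_injective
  refine ⟨g, C mb * a, C ma * b, C (m ^ (k-1)) * h, m * ma * mb, mh,
    by simp [hm, hma, hmb], hmh, ?_, ?_⟩
  · apply inj
    simp only [Polynomial.map_add, Polynomial.map_mul, Polynomial.map_C, ← Polynomial.derivative_map, hg, ha, hb]
    simp only [derivative_mul, derivative_C, zero_mul, zero_add, map_mul, eq_intCast]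
    linear_combination (C (m:ℚ) * C (ma:ℚ) * C (mb:ℚ)) * hAB
  · apply inj
    simp only [Polynomial.map_mul, Polynomial.map_pow, Polynomial.map_C, hg, hh]
    simp only [map_pow, eq_intCast, mul_pow]
    rw [hH]
    ring

theorem count_part (g a b : ℤ[X]) (r A : ℤ) (M p T : ℕ) (hp : p.Prime)
    (hr : ¬ (p : ℤ) ∣ r) (hM : ¬ p ∣ M) (hab : a * g + b * derivative g = C r) :
    ((Finset.range T).filter (fun t : ℕ => (p : ℤ) ^ 2 ∣ g.eval (A + M * t))).card ≤
      g.natDegree * (T / p ^ 2 + 1) := by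
  classical
  have : Fact p.Prime := ⟨hp⟩
  have hpZ : Prime (p : ℤ) := Nat.prime_iff_prime_int.1 hp
  set G := g.map (Int.castRingHom (ZMod p)) with hG
  have hG0 : G ≠ 0 := by
    intro h0
    have e := congrArg (Polynomial.map (Int.castRingHom (ZMod p))) hab
    simp only [Polynomial.map_add, Polynomial.map_mul, Polynomial.map_C, ← Polynomial.derivative_map] at e
    rw [← hG, h0] at e
    simp only [mul_zero, derivative_zero, add_zero] at e
    have e2 := (Polynomial.C_eq_zero.1 e.symm)
    rw [eq_intCast, ZMod.intCast_zmod_eq_zero_iff_dvd] at e2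
    exact hr e2
  set S := (Finset.range T).filter (fun t : ℕ => (p : ℤ) ^ 2 ∣ g.eval (A + M * t)) with hS
  let φ : ℕ → ZMod p := fun t => ((A + M * t : ℤ) : ZMod p)
  have himg : ∀ t ∈ S, φ t ∈ G.roots.toFinset := by
    intro t ht
    rw [Multiset.mem_toFinset, Polynomial.mem_roots hG0, IsRoot.def]
    have h1 : (p : ℤ) ∣ g.eval (A + M * t) :=
      (Dvd.intro_left _ (by ring : (p : ℤ) * p = p ^ 2)).trans (Finset.mem_filter.1 ht).2
    rw [← ZMod.intCast_zmod_eq_zero_iff_dvd] at h1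
    rw [hG, show φ t = (Int.castRingHom (ZMod p)) (A + M * t : ℤ) from rfl,
      Polynomial.eval_map, Polynomial.eval₂_at_apply]
    exact h1
  have hfib : ∀ x ∈ G.roots.toFinset, (S.filter (fun t => φ t = x)).card ≤ T / p ^ 2 + 1 := by
    intro x _
    rw [← Finset.card_range (T / p ^ 2 + 1)]
    apply Finset.card_le_card_of_injOn (fun t => t / p ^ 2)
    · intro t ht
      simp only [Finset.coe_filter, Set.mem_ofPred_eq, hS, Finset.mem_filter, Finset.mem_range] at ht
      simp only [Finset.coe_range, Set.mem_Iio]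
      exact Nat.lt_succ_of_le (Nat.div_le_div_right ht.1.1.le)
    · intro s hs t ht hst
      simp only [Finset.coe_filter, Set.mem_ofPred_eq, hS, Finset.mem_filter, Finset.mem_range] at hs ht
      have h1 : φ t = φ s := ht.2.trans hs.2.symm
      set u : ℤ := A + M * s with hu
      set v : ℤ := A + M * t with hv
      have h2 : (p : ℤ) ∣ v - u := by
        rw [← ZMod.intCast_zmod_eq_zero_iff_dvd]
        push_cast
        exact sub_eq_zero.2 h1
      obtain ⟨w, hw⟩ := Polynomial.binomExpansion g u (v - u)
      rw [add_sub_cancel] at hw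
      have hw2 : g.eval v - g.eval u = (v - u) * (eval u (derivative g) + w * (v - u)) := by
        rw [hw]; ring
      have h3 : (p : ℤ) ^ 2 ∣ (v - u) * (eval u (derivative g) + w * (v - u)) := by
        rw [← hw2]; exact dvd_sub ht.1.2 hs.1.2
      have h4 : ¬ (p : ℤ) ∣ (eval u (derivative g) + w * (v - u)) := by
        intro h
        have h5 : (p : ℤ) ∣ eval u (derivative g) := (dvd_add_left (h2.mul_left w)).1 h
        have h6 : (p : ℤ) ∣ eval u g :=
          (Dvd.intro_left _ (by ring : (p : ℤ) * p = p ^ 2)).trans hs.1.2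
        have e := congrArg (Polynomial.eval u) hab
        simp only [eval_add, eval_mul, eval_C] at e
        exact hr (e ▸ dvd_add (h6.mul_left _) (h5.mul_left _))
      have h7 : (p : ℤ) ^ 2 ∣ v - u := hpZ.pow_dvd_of_dvd_mul_right 2 h4 h3
      have h8 : (p : ℤ) ^ 2 ∣ (t - s : ℤ) * M := by
        have : v - u = (t - s : ℤ) * M := by rw [hu, hv]; ring
        rwa [this] at h7
      have h9 : (p : ℤ) ^ 2 ∣ (t - s : ℤ) :=
        hpZ.pow_dvd_of_dvd_mul_right 2 (fun h => hM (by exact_mod_cast h)) h8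
      have h10 : s ≡ t [MOD p ^ 2] := by
        rw [Nat.modEq_iff_dvd]; push_cast; exact h9
      have h11 : s / p ^ 2 = t / p ^ 2 := hst
      rw [← Nat.div_add_mod s (p ^ 2), ← Nat.div_add_mod t (p ^ 2), h11, h10]
  calc S.card ≤ (T / p ^ 2 + 1) * (G.roots.toFinset).card :=
        Finset.card_le_mul_card_image_of_maps_to himg _ hfib
    _ ≤ (T / p ^ 2 + 1) * g.natDegree := by
        gcongr
        exact (Multiset.toFinset_card_le _).trans ((Polynomial.card_roots' _).trans natDegree_map_le)
    _ = _ := mul_comm _ _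

theorem prime_part (B D : ℕ) : ∃ T : ℕ, 1 ≤ T ∧
    2 * D * (Nat.primeCounting (B * T) : ℝ) ≤ T := by
  rcases Nat.eq_zero_or_pos B with rfl | hB
  · exact ⟨1, le_rfl, by simp [Nat.primeCounting_zero]⟩
  have h1 := Chebyshev.eventually_primeCounting_le (ε := 1) one_pos
  have h2 : ∀ᶠ x : ℝ in Filter.atTop, 2 * D * (Real.log 4 + 1) * B ≤ Real.log x :=
    Real.tendsto_log_atTop.eventually_ge_atTop _
  have h3 : Filter.Tendsto (fun T : ℕ => (B : ℝ) * T) Filter.atTop Filter.atTop :=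
    Filter.Tendsto.const_mul_atTop (by exact_mod_cast hB) tendsto_natCast_atTop_atTop
  have h4 : ∀ᶠ x : ℝ in Filter.atTop, 0 < Real.log x :=
    Real.tendsto_log_atTop.eventually_gt_atTop _
  obtain ⟨T, ⟨hT1, hT2, hT4⟩, hT3⟩ := ((h3.eventually (h1.and (h2.and h4))).and
    (Filter.eventually_ge_atTop 1)).exists
  refine ⟨T, hT3, ?_⟩
  have e : ⌊(B : ℝ) * T⌋₊ = B * T := by
    rw [← Nat.cast_mul]; exact Nat.floor_natCast _
  rw [e] at hT1
  calc 2 * D * (Nat.primeCounting (B * T) : ℝ)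
      ≤ 2 * D * ((Real.log 4 + 1) * (B * T) / Real.log (B * T)) := by gcongr
    _ = (2 * D * (Real.log 4 + 1) * B) / Real.log (B * T) * T := by ring
    _ ≤ 1 * T := by
        gcongr
        rw [div_le_one hT4]; exact hT2
    _ = T := one_mul _

theorem size_part (k : ℕ) (f : ℤ[X]) (hdeg : f.natDegree ≤ k) :
    ∃ c : ℕ, 1 ≤ c ∧ ∀ n : ℕ, 1 ≤ n → |f.eval (n : ℤ)| ≤ c * (n : ℤ) ^ k := by
  refine ⟨(∑ i ∈ Finset.range (k + 1), (f.coeff i).natAbs) + 1, by omega, fun n hn => ?_⟩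
  rw [Polynomial.eval_eq_sum_range' (Nat.lt_succ_of_le hdeg)]
  have hn' : (1 : ℤ) ≤ n := by exact_mod_cast hn
  calc |∑ i ∈ Finset.range (k + 1), f.coeff i * (n : ℤ) ^ i|
      ≤ ∑ i ∈ Finset.range (k + 1), |f.coeff i * (n : ℤ) ^ i| := Finset.abs_sum_le_sum_abs _ _
    _ ≤ ∑ i ∈ Finset.range (k + 1), |f.coeff i| * (n : ℤ) ^ k := by
        refine Finset.sum_le_sum fun i hi => ?_
        rw [abs_mul, abs_of_nonneg (by positivity : (0 : ℤ) ≤ (n : ℤ) ^ i)]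
        gcongr
        exact Nat.lt_succ_iff.1 (Finset.mem_range.1 hi)
    _ = (∑ i ∈ Finset.range (k + 1), |f.coeff i|) * (n : ℤ) ^ k := by rw [Finset.sum_mul]
    _ ≤ _ := by
        gcongr
        push_cast
        linarith

theorem crt_part (k : ℕ) (f : ℤ[X])
    (hloc : ∀ p : ℕ, p.Prime →
      ∃ x : ZMod (p ^ k),
        Polynomial.eval x (f.map (Int.castRingHom (ZMod (p ^ k)))) ≠ 0) (z : ℕ) :
    ∃ A : ℕ, ∀ p : ℕ, p.Prime → p ≤ z → ¬ (p : ℤ) ^ k ∣ f.eval (A : ℤ) := by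
  have h : ∀ p : ℕ, ∃ a : ℕ, p.Prime → ¬ (p : ℤ) ^ k ∣ f.eval (a : ℤ) := by
    intro p
    by_cases hp : p.Prime
    · obtain ⟨x, hx⟩ := hloc p hp
      have : NeZero (p ^ k) := ⟨pow_ne_zero _ hp.ne_zero⟩
      refine ⟨x.val, fun _ hd => hx ?_⟩
      have e : x = (Int.castRingHom (ZMod (p ^ k))) (x.val : ℤ) := by simp
      rw [e, Polynomial.eval_map, Polynomial.eval₂_at_apply, eq_intCast,
        ZMod.intCast_zmod_eq_zero_iff_dvd]
      simpa using hd
    · exact ⟨0, fun h => absurd h hp⟩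
  choose a ha using h
  obtain ⟨A, hA⟩ := Nat.chineseRemainderOfFinset a (fun p => p ^ k)
    ((Finset.range (z + 1)).filter Nat.Prime)
    (fun p hp => pow_ne_zero _ (Finset.mem_filter.1 hp).2.ne_zero)
    (by
      intro p hp q hq hpq
      exact Nat.Coprime.pow _ _ ((Nat.coprime_primes (Finset.mem_filter.1 hp).2
        (Finset.mem_filter.1 hq).2).2 hpq))
  refine ⟨A, fun p hp hpz hd => ha p hp ?_⟩
  have h1 := hA p (Finset.mem_filter.2 ⟨Finset.mem_range.2 (by omega), hp⟩)
  have h2 := (Nat.modEq_iff_dvd.1 h1).trans (Polynomial.sub_dvd_eval_sub (a p : ℤ) (A : ℤ) f)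
  push_cast at h2
  simpa using dvd_add h2 hd

set_option maxHeartbeats 1000000 in
theorem kth_power_free_values_low_degree (k : ℕ) (hk : 2 ≤ k) (f : Polynomial ℤ)
    (hdeg : f.natDegree ≤ k)
    (hnokth : ∀ g : Polynomial ℤ, g ^ k ∣ f → IsUnit g)
    (hloc : ∀ p : ℕ, p.Prime →
      ∃ x : ZMod (p ^ k),
        Polynomial.eval x (f.map (Int.castRingHom (ZMod (p ^ k)))) ≠ 0) :
    {n : ℤ | ∀ d : ℤ, d ^ k ∣ f.eval n → d = 1 ∨ d = -1}.Infinite := by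
  classical
  have hf : f ≠ 0 := by
    rintro rfl
    exact Polynomial.not_isUnit_X (hnokth X (dvd_zero _))
  have hk0 : k ≠ 0 := by omega
  obtain ⟨g, a, b, h, r, c, hr, hc, hab, hgf⟩ := alg_part k hk f hf hnokth
  obtain ⟨K, hK1, hK⟩ := size_part k f hdeg
  set D := g.natDegree with hD
  set z : ℕ := r.natAbs + c.natAbs + 8 * D + 1 with hz
  obtain ⟨A0, hA0⟩ := crt_part k f hloc z
  set M : ℕ := ∏ q ∈ (Finset.range (z + 1)).filter Nat.Prime, q ^ k with hMdef
  have hMpos : 0 < M := Finset.prod_pos fun q hq => pow_pos (Finset.mem_filter.1 hq).2.pos _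
  obtain ⟨R, hR⟩ := f.roots.toFinset.bddAbove
  apply Set.infinite_of_forall_exists_gt
  intro N0
  set A : ℕ := A0 + M * (R.natAbs + N0.natAbs + 1) with hA
  have hAge : R.natAbs + N0.natAbs + 1 ≤ A :=
    (Nat.le_mul_of_pos_left _ hMpos).trans (Nat.le_add_left _ _)
  set B : ℕ := K * (A + M) with hB
  obtain ⟨T, hT1, hT⟩ := prime_part B D
  -- nonvanishing
  have hne : ∀ t : ℕ, f.eval ((A : ℤ) + M * t) ≠ 0 := by
    intro t h0
    have h1 : ((A : ℤ) + M * t) ≤ R := hR (by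
      rw [Finset.mem_coe, Multiset.mem_toFinset, Polynomial.mem_roots hf]; exact h0)
    have h2 : (0 : ℤ) ≤ M * t := by positivity
    omega
  -- the prime is large
  have hlarge : ∀ (t p : ℕ), p.Prime → (p : ℤ) ^ k ∣ f.eval ((A : ℤ) + M * t) → z < p := by
    intro t p hp hd
    by_contra! hpz
    apply hA0 p hp hpz
    have h1 : (p ^ k : ℕ) ∣ M := Finset.dvd_prod_of_mem (fun q => q ^ k)
      (Finset.mem_filter.2 ⟨Finset.mem_range.2 (by omega), hp⟩)
    have h2 : (p : ℤ) ^ k ∣ M := by exact_mod_cast h1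
    have h3 : (p : ℤ) ^ k ∣ ((A : ℤ) + M * t) - A0 := by
      have : ((A : ℤ) + M * t) - A0 = M * ((R.natAbs + N0.natAbs + 1 : ℕ) + t) := by
        rw [hA]; push_cast; ring
      rw [this]; exact h2.mul_right _
    have h4 := h3.trans (Polynomial.sub_dvd_eval_sub _ _ f)
    simpa using dvd_sub hd h4
  -- the prime is not too large
  have hsmall : ∀ (t p : ℕ), t < T → p.Prime →
      (p : ℤ) ^ k ∣ f.eval ((A : ℤ) + M * t) → p ≤ B * T := by
    intro t p ht hp hd
    have h1 := Int.le_of_dvd (abs_pos.2 (hne t)) ((dvd_abs _ _).2 hd)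
    have h2 := hK (A + M * t) (by omega)
    push_cast at h2
    have h3 : (p : ℤ) ^ k ≤ ((K : ℤ) * (A + M * t)) ^ k := by
      refine (h1.trans h2).trans ?_
      rw [mul_pow]
      gcongr
      exact le_self_pow₀ (by exact_mod_cast hK1) hk0
    have h4 : p ^ k ≤ (K * (A + M * t)) ^ k := by exact_mod_cast h3
    have h5 := (Nat.pow_le_pow_iff_left hk0).1 h4
    refine h5.trans ?_
    rw [hB, mul_assoc]
    gcongr
    nlinarith
  have hsq : ∀ (t p : ℕ), p.Prime → (p : ℤ) ^ k ∣ f.eval ((A : ℤ) + M * t) →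
      (p : ℤ) ^ 2 ∣ g.eval ((A : ℤ) + M * t) := by
    intro t p hp hd
    have hpz := hlarge t p hp hd
    have hpZ : Prime (p : ℤ) := Nat.prime_iff_prime_int.1 hp
    have e := congrArg (Polynomial.eval ((A : ℤ) + M * t)) hgf
    simp only [eval_mul, eval_C, eval_pow] at e
    have hcp : ¬ (p : ℤ) ∣ c := by
      intro hdc
      have := Nat.le_of_dvd (Int.natAbs_pos.2 hc) (Int.natCast_dvd.1 hdc)
      omega
    have h1 : (p : ℤ) ^ k ∣ (eval ((A : ℤ) + M * t) g) ^ (k - 1) :=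
      hpZ.pow_dvd_of_dvd_mul_left k hcp (e ▸ hd.mul_right _)
    set w := eval ((A : ℤ) + M * t) g with hw
    have h2 : (p : ℤ) ∣ w := hpZ.dvd_of_dvd_pow ((dvd_pow_self _ hk0).trans h1)
    obtain ⟨v, hv⟩ := h2
    rw [hv, mul_pow] at h1
    have hk1 : (p : ℤ) ^ k = (p : ℤ) ^ (k - 1) * p := by
      rw [← pow_succ]; congr 1; omega
    rw [hk1] at h1
    have h3 := (mul_dvd_mul_iff_left (pow_ne_zero _ hpZ.ne_zero)).1 h1
    have h4 := hpZ.dvd_of_dvd_pow h3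
    rw [hv, sq]
    exact mul_dvd_mul_left _ h4
  -- the counting
  have hexists : ∃ t < T, ∀ p : ℕ, p.Prime → ¬ (p : ℤ) ^ k ∣ f.eval ((A : ℤ) + M * t) := by
    by_contra! hcon
    set P := (Finset.Ioc z (B * T)).filter Nat.Prime with hP
    have hsub : Finset.range T ⊆ P.biUnion (fun p =>
        (Finset.range T).filter (fun t : ℕ => (p : ℤ) ^ 2 ∣ g.eval ((A : ℤ) + M * t))) := by
      intro t ht
      obtain ⟨p, hp, hd⟩ := hcon t (Finset.mem_range.1 ht)
      rw [Finset.mem_biUnion]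
      exact ⟨p, Finset.mem_filter.2 ⟨Finset.mem_Ioc.2 ⟨hlarge t p hp hd,
        hsmall t p (Finset.mem_range.1 ht) hp hd⟩, hp⟩,
        Finset.mem_filter.2 ⟨ht, hsq t p hp hd⟩⟩
    have hcard : T ≤ ∑ p ∈ P, D * (T / p ^ 2 + 1) := by
      calc T = (Finset.range T).card := (Finset.card_range T).symm
        _ ≤ _ := Finset.card_le_card hsub
        _ ≤ _ := Finset.card_biUnion_le
        _ ≤ _ := by
          refine Finset.sum_le_sum fun p hp => ?_
          obtain ⟨hp1, hp⟩ := Finset.mem_filter.1 hp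
          have hpz := (Finset.mem_Ioc.1 hp1).1
          refine count_part g a b r A M p T hp ?_ ?_ hab
          · intro hdr
            have := Nat.le_of_dvd (Int.natAbs_pos.2 hr) (Int.natCast_dvd.1 hdr)
            omega
          · intro hdM
            obtain ⟨q, hq, hpq⟩ := (hp.prime.dvd_finsetProd_iff _).1 hdM
            obtain ⟨hq1, hq⟩ := Finset.mem_filter.1 hq
            have := Nat.le_of_dvd hq.pos (hp.dvd_of_dvd_pow hpq)
            have := Finset.mem_range.1 hq1
            omega
    have hPcard : P.card ≤ Nat.primeCounting (B * T) := by
      rw [Nat.primeCounting, Nat.primeCounting', Nat.count_eq_card_filter_range]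
      apply Finset.card_le_card
      intro p hp
      obtain ⟨hp1, hp⟩ := Finset.mem_filter.1 hp
      exact Finset.mem_filter.2 ⟨Finset.mem_range.2
        (Nat.lt_succ_of_le (Finset.mem_Ioc.1 hp1).2), hp⟩
    have hsum : ∑ p ∈ P, ((p : ℝ) ^ 2)⁻¹ ≤ 2 / (z + 1) := by
      refine le_trans ?_ (sum_Ioo_inv_sq_le z (B * T + 1))
      refine Finset.sum_le_sum_of_subset_of_nonneg ?_ (fun _ _ _ => by positivity)
      intro p hp
      have := Finset.mem_Ioc.1 (Finset.mem_filter.1 hp).1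
      exact Finset.mem_Ioo.2 ⟨this.1, by omega⟩
    have hreal : (T : ℝ) ≤ D * T * (2 / (z + 1)) + D * Nat.primeCounting (B * T) := by
      calc (T : ℝ) ≤ ((∑ p ∈ P, D * (T / p ^ 2 + 1) : ℕ) : ℝ) := by exact_mod_cast hcard
        _ ≤ ∑ p ∈ P, (D * T * ((p : ℝ) ^ 2)⁻¹ + D) := by
          push_cast
          refine Finset.sum_le_sum fun p _ => ?_
          have h1 : ((T / p ^ 2 : ℕ) : ℝ) ≤ T / (p : ℝ) ^ 2 := by
            have := @Nat.cast_div_le ℝ _ _ _ T (p ^ 2)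
            push_cast at this
            exact this
          calc (D : ℝ) * (((T / p ^ 2 : ℕ) : ℝ) + 1) ≤ D * (T / (p : ℝ) ^ 2 + 1) := by gcongr
            _ = _ := by ring
        _ = D * T * (∑ p ∈ P, ((p : ℝ) ^ 2)⁻¹) + D * P.card := by
          rw [Finset.sum_add_distrib, ← Finset.mul_sum, Finset.sum_const, nsmul_eq_mul]
          ring
        _ ≤ _ := by
          gcongr
    have hT0 : (1 : ℝ) ≤ T := by exact_mod_cast hT1
    have h1 : (D : ℝ) * (2 / (z + 1)) ≤ 1 / 4 := by
      rw [mul_div_assoc', div_le_div_iff₀ (by positivity) (by norm_num)]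
      have : ((8 * D : ℕ) : ℝ) ≤ z := by exact_mod_cast (by omega : 8 * D ≤ z)
      push_cast at this
      linarith
    have h2 : (D : ℝ) * T * (2 / (z + 1)) ≤ 1 / 4 * T := by
      calc (D : ℝ) * T * (2 / (z + 1)) = D * (2 / (z + 1)) * T := by ring
        _ ≤ _ := by gcongr
    linarith
  obtain ⟨t, _, ht⟩ := hexists
  refine ⟨(A : ℤ) + M * t, ?_, ?_⟩
  · intro d hd
    by_contra! hcon
    have hd1 : d.natAbs ≠ 1 := by
      intro h
      rcases Int.natAbs_eq d with h' | h' <;> rw [h] at h'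
      · exact hcon.1 (by simpa using h')
      · exact hcon.2 (by simpa using h')
    obtain ⟨p, hp, hpd⟩ := Nat.exists_prime_and_dvd hd1
    exact ht p hp ((pow_dvd_pow_of_dvd (Int.natCast_dvd.2 hpd) k).trans hd)
  · have h2 : (0 : ℤ) ≤ M * t := by positivity
    omega
end

section
/- The number of integers d ≤ N with ω₂(d) ≥ (1-ε)·log log N and ω₁(d) = 0, where ω₁ counts prime divisors from a set of primes of relative density 2/3 and ω₂ from a complementary set of density 1/3 (in the sense Σ_{p∈P₂, p≤z} 1/p ~ (1/3) log log z), is O(N/(log N)^{log 3 - ε'}) for some ε' → 0 as ε → 0. -/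
open Filter
open scoped Classical
open scoped ArithmeticFunction.vonMangoldt

lemma primes_upper (δ : ℝ) (hδ : 0 < δ) : ∃ K : ℝ, ∀ᶠ z : ℕ in atTop,
    ∑ p ∈ (Finset.range (z + 1)).filter Nat.Prime, (1 : ℝ) / p ≤
      Real.exp δ * Real.log (Real.log z) + K := by
  have hb := (log_riemannZeta_add_log_sub_isLittleO_ofReal).bound (c := 1) one_pos
  have hlog : Tendsto (fun z : ℕ => Real.log z) atTop atTop :=
    Real.tendsto_log_atTop.comp tendsto_natCast_atTop_atTop
  have ht : Tendsto (fun z : ℕ => 1 + δ / Real.log z) atTop (nhdsWithin 1 (Set.Ioi 1)) := by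
    refine tendsto_nhdsWithin_iff.2 ⟨?_, ?_⟩
    · simpa using (tendsto_const_nhds (x := (1:ℝ))).add (hlog.const_div_atTop δ)
    · filter_upwards [hlog.eventually_gt_atTop 0] with z hz
      have : 0 < δ / Real.log z := by positivity
      simpa using this
  refine ⟨Real.exp δ * (1 - Real.log δ), ?_⟩
  filter_upwards [ht.eventually hb, hlog.eventually_gt_atTop 0] with z h1 hz
  set s : ℝ := 1 + δ / Real.log z with hs
  have hs1 : 1 < s := by
    have : 0 < δ / Real.log z := by positivity
    linarith
  have h2 : Real.log (riemannZeta (s:ℂ)).re ≤ Real.log (Real.log z) - Real.log δ + 1 := by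
    have h3 := (le_abs_self _).trans (by simpa using h1)
    have h4 : Real.log (s - 1) = Real.log δ - Real.log (Real.log z) := by
      rw [hs, add_sub_cancel_left, Real.log_div hδ.ne' hz.ne']
    rw [h4] at h3
    linarith
  have hnn : ∀ n : ℕ, 0 ≤ Λ n / ((n:ℝ) ^ s * Real.log n) := fun n =>
    div_nonneg ArithmeticFunction.vonMangoldt_nonneg
      (mul_nonneg (by positivity) (Real.log_natCast_nonneg n))
  have hsum : Summable (fun n : ℕ => Λ n / ((n:ℝ) ^ s * Real.log n)) := by
    refine Summable.of_nonneg_of_le hnn (fun n => ?_) (Real.summable_one_div_nat_rpow.2 hs1)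
    rcases (Real.log_natCast_nonneg n).eq_or_lt with h | h
    · rw [← h]; simp; positivity
    · have h0 : (n:ℝ) ≠ 0 := by rintro h'; rw [h'] at h; simp at h
      have : 0 < (n:ℝ)^s := by positivity
      rw [div_le_div_iff₀ (by positivity) this]
      have := ArithmeticFunction.vonMangoldt_le_log (n := n)
      nlinarith
  have h5 : ∑ p ∈ (Finset.range (z + 1)).filter Nat.Prime, Λ p / ((p:ℝ) ^ s * Real.log p) ≤
      Real.log (riemannZeta (s:ℂ)).re := by
    rw [log_riemannZeta_eq hs1]
    exact hsum.sum_le_tsum _ (fun n _ => hnn n)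
  have h6 : ∑ p ∈ (Finset.range (z + 1)).filter Nat.Prime, (1:ℝ) / p ≤
     Real.exp δ * ∑ p ∈ (Finset.range (z + 1)).filter Nat.Prime, Λ p / ((p:ℝ) ^ s * Real.log p) := by
    rw [Finset.mul_sum]
    refine Finset.sum_le_sum fun p hp => ?_
    simp only [Finset.mem_filter, Finset.mem_range] at hp
    obtain ⟨hpz, hp⟩ := hp
    have hp0 : (0:ℝ) < p := by exact_mod_cast hp.pos
    have hlp : 0 < Real.log p := Real.log_pos (by exact_mod_cast hp.one_lt)
    have hle : Real.log p ≤ Real.log z :=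
      Real.log_le_log hp0 (by exact_mod_cast Nat.lt_succ_iff.1 hpz)
    rw [ArithmeticFunction.vonMangoldt_apply_prime hp, mul_comm ((p:ℝ)^s), ← div_div, div_self hlp.ne']
    rw [hs, Real.rpow_add hp0, Real.rpow_one, Real.rpow_def_of_pos hp0]
    have h7 : Real.exp (Real.log p * (δ / Real.log z)) ≤ Real.exp δ := by
      apply Real.exp_le_exp.2
      rw [mul_div_assoc', div_le_iff₀ hz]
      nlinarith
    rw [mul_one_div, div_le_div_iff₀ hp0 (by positivity)]
    nlinarith
  calc _ ≤ _ := h6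
    _ ≤ Real.exp δ * (Real.log (Real.log z) - Real.log δ + 1) := by
      gcongr; exact h5.trans h2
    _ = _ := by ring

/-- the weight -/
noncomputable def wt (P₁ P₂ : Set ℕ) : ArithmeticFunction ℝ where
  toFun n := if n = 0 then 0 else if (n.primeFactors.filter (fun p => p ∈ P₁)).card = 0 then
    3 ^ (n.primeFactors.filter (fun p => p ∈ P₂)).card else 0
  map_zero' := by simp

lemma wt_apply (P₁ P₂ : Set ℕ) {n : ℕ} (hn : n ≠ 0) : wt P₁ P₂ n =
    if (n.primeFactors.filter (fun p => p ∈ P₁)).card = 0 then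
    3 ^ (n.primeFactors.filter (fun p => p ∈ P₂)).card else 0 := by
  show (if n = 0 then _ else _) = _
  rw [if_neg hn]

lemma wt_nonneg (P₁ P₂ : Set ℕ) (n : ℕ) : 0 ≤ wt P₁ P₂ n := by
  show 0 ≤ (if n = 0 then (0:ℝ) else _)
  split_ifs <;> positivity

lemma wt_one (P₁ P₂ : Set ℕ) : wt P₁ P₂ 1 = 1 := by
  simp [wt_apply]

lemma wt_mul (P₁ P₂ : Set ℕ) {m n : ℕ} (h : m.Coprime n) :
    wt P₁ P₂ (m * n) = wt P₁ P₂ m * wt P₁ P₂ n := by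
  rcases eq_or_ne m 0 with rfl | hm
  · simp
  rcases eq_or_ne n 0 with rfl | hn
  · simp
  rw [wt_apply _ _ (mul_ne_zero hm hn), wt_apply _ _ hm, wt_apply _ _ hn, h.primeFactors_mul,
    Finset.filter_union, Finset.filter_union,
    Finset.card_union_of_disjoint (Finset.disjoint_filter_filter h.disjoint_primeFactors),
    Finset.card_union_of_disjoint (Finset.disjoint_filter_filter h.disjoint_primeFactors),
    pow_add]
  split_ifs <;> first | omega | simp

lemma wt_prime_pow (P₁ P₂ : Set ℕ) {p k : ℕ} (hp : p.Prime) (hk : k ≠ 0) :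
    wt P₁ P₂ (p ^ k) = wt P₁ P₂ p := by
  rw [wt_apply _ _ (pow_ne_zero _ hp.ne_zero), wt_apply _ _ hp.ne_zero, Nat.primeFactors_pow _ hk]

lemma wt_mul_prime_pow_le (P₁ P₂ : Set ℕ) {a p k : ℕ} (ha : a ≠ 0) (hp : p.Prime) (hk : k ≠ 0) :
    wt P₁ P₂ (a * p ^ k) ≤ 3 * wt P₁ P₂ a := by
  have hpk : p ^ k ≠ 0 := pow_ne_zero _ hp.ne_zero
  rw [wt_apply _ _ (mul_ne_zero ha hpk), wt_apply _ _ ha, Nat.primeFactors_mul ha hpk,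
    Nat.primeFactors_pow _ hk, hp.primeFactors, Finset.filter_union, Finset.filter_union]
  split_ifs with h1 h2
  · rw [← pow_succ']
    refine pow_le_pow_right₀ (by norm_num) ((Finset.card_union_le _ _).trans ?_)
    gcongr
    exact (Finset.card_filter_le _ _).trans (by simp)
  · exact absurd (Nat.le_zero.1 (h1 ▸ Finset.card_le_card Finset.subset_union_left)) h2
  · positivity
  · simp

lemma wt_log_le (P₁ P₂ : Set ℕ) (n : ℕ) :
    wt P₁ P₂ n * Real.log n ≤ 3 * (wt P₁ P₂ * Λ) n := by
  rcases eq_or_ne n 0 with rfl | hn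
  · simp
  rw [ArithmeticFunction.mul_apply, ← ArithmeticFunction.vonMangoldt_sum,
    Nat.sum_divisorsAntidiagonal' (fun a b => wt P₁ P₂ a * Λ b), Finset.mul_sum, Finset.mul_sum]
  refine Finset.sum_le_sum fun q hq => ?_
  have hqn := Nat.dvd_of_mem_divisors hq
  by_cases hpp : IsPrimePow q
  · obtain ⟨p, k, hp, hk, rfl⟩ := hpp
    have h1 := wt_mul_prime_pow_le P₁ P₂ (a := n / p ^ k)
      (Nat.div_pos (Nat.le_of_dvd (Nat.pos_of_ne_zero hn) hqn)
        (Nat.pos_of_ne_zero (ne_zero_of_dvd_ne_zero hn hqn))).ne' hp.nat_prime hk.ne'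
    rw [Nat.div_mul_cancel hqn] at h1
    rw [← mul_assoc]
    exact mul_le_mul_of_nonneg_right h1 ArithmeticFunction.vonMangoldt_nonneg
  · rw [ArithmeticFunction.vonMangoldt_eq_zero_iff.2 hpp]; simp

lemma wt_sum_le (P₁ P₂ : Set ℕ) (N : ℕ) :
    (∑ n ∈ Finset.Ioc 0 N, wt P₁ P₂ n) * Real.log N ≤
      (3 * (Real.log 4 + 4) + 1) * N * ∑ n ∈ Finset.Ioc 0 N, wt P₁ P₂ n / n := by
  have h1 : ∑ n ∈ Finset.Ioc 0 N, wt P₁ P₂ n * Real.log n ≤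
      3 * (Real.log 4 + 4) * N * ∑ n ∈ Finset.Ioc 0 N, wt P₁ P₂ n / n := by
    calc _ ≤ ∑ n ∈ Finset.Ioc 0 N, 3 * (wt P₁ P₂ * Λ) n :=
          Finset.sum_le_sum fun n _ => wt_log_le P₁ P₂ n
      _ = 3 * ∑ n ∈ Finset.Ioc 0 N, wt P₁ P₂ n * Chebyshev.psi ((N / n : ℕ) : ℝ) := by
        rw [← Finset.mul_sum, ArithmeticFunction.sum_Ioc_mul_eq_sum_sum]
        simp only [Chebyshev.psi, Nat.floor_natCast]
      _ ≤ 3 * ∑ n ∈ Finset.Ioc 0 N, wt P₁ P₂ n * ((Real.log 4 + 4) * (N / n)) := by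
        gcongr with n hn
        · exact wt_nonneg _ _ _
        · refine (Chebyshev.psi_le_const_mul_self (by positivity)).trans ?_
          gcongr
          exact Nat.cast_div_le
      _ = _ := by
        rw [Finset.mul_sum, Finset.mul_sum]
        refine Finset.sum_congr rfl fun n _ => by ring
  have h2 : ∑ n ∈ Finset.Ioc 0 N, wt P₁ P₂ n * (Real.log N - Real.log n) ≤
      N * ∑ n ∈ Finset.Ioc 0 N, wt P₁ P₂ n / n := by
    rw [Finset.mul_sum]
    refine Finset.sum_le_sum fun n hn => ?_
    rw [Finset.mem_Ioc] at hn
    have hn0 : (0:ℝ) < n := by exact_mod_cast hn.1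
    have hN0 : (0:ℝ) < N := by exact_mod_cast hn.1.trans_le hn.2
    rw [← Real.log_div hN0.ne' hn0.ne']
    calc _ ≤ wt P₁ P₂ n * (N / n) :=
          mul_le_mul_of_nonneg_left (Real.log_le_self (by positivity)) (wt_nonneg _ _ _)
      _ = _ := by ring
  have h3 : (∑ n ∈ Finset.Ioc 0 N, wt P₁ P₂ n) * Real.log N =
    ∑ n ∈ Finset.Ioc 0 N, wt P₁ P₂ n * Real.log n +
    ∑ n ∈ Finset.Ioc 0 N, wt P₁ P₂ n * (Real.log N - Real.log n) := by
    rw [Finset.sum_mul, ← Finset.sum_add_distrib]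
    exact Finset.sum_congr rfl fun n _ => by ring
  rw [h3]
  linarith

lemma hasSum_wt (P₁ P₂ : Set ℕ) {p : ℕ} (hp : p.Prime) :
    HasSum (fun n : ℕ => wt P₁ P₂ (p ^ n) / ((p ^ n : ℕ) : ℝ)) (1 + wt P₁ P₂ p / (p - 1)) := by
  have hp1 : (1:ℝ) < p := by exact_mod_cast hp.one_lt
  rw [← hasSum_nat_add_iff' 1]
  have hg := (hasSum_geometric_of_lt_one (r := (p:ℝ)⁻¹) (by positivity)
    (inv_lt_one_of_one_lt₀ hp1)).mul_left (wt P₁ P₂ p / p)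
  have e1 : (fun n : ℕ => wt P₁ P₂ (p ^ (n + 1)) / ((p ^ (n + 1) : ℕ) : ℝ)) =
      fun n : ℕ => wt P₁ P₂ p / p * ((p:ℝ)⁻¹) ^ n := by
    funext n
    rw [wt_prime_pow P₁ P₂ hp (Nat.succ_ne_zero n)]
    rw [inv_pow, Nat.cast_pow, pow_succ', ← div_eq_mul_inv, div_div]
  have e2 : 1 + wt P₁ P₂ p / ((p:ℝ) - 1) -
      ∑ i ∈ Finset.range 1, wt P₁ P₂ (p ^ i) / ((p ^ i : ℕ) : ℝ) =
      wt P₁ P₂ p / p * (1 - (p:ℝ)⁻¹)⁻¹ := by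
    have : (p:ℝ) - 1 ≠ 0 := by linarith
    simp [wt_one]
    field_simp
  rw [e1, e2]
  exact hg

lemma wt_div_sum_le (P₁ P₂ : Set ℕ) (N : ℕ) :
    ∑ n ∈ Finset.Ioc 0 N, wt P₁ P₂ n / n ≤
      Real.exp (∑ p ∈ (Finset.range (N + 1)).filter Nat.Prime, wt P₁ P₂ p / ((p:ℝ) - 1)) := by
  have key := (EulerProduct.summable_and_hasSum_smoothNumbers_prod_primesBelow_tsum
    (f := fun n : ℕ => wt P₁ P₂ n / (n:ℝ)) (by simp [wt_one])
    (fun {m n} h => by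
      simp only [wt_mul P₁ P₂ h]; push_cast; rw [mul_div_mul_comm])
    (fun {p} hp => (hasSum_wt P₁ P₂ hp).summable.norm) (N + 1)).2
  have h1 : ∑ n ∈ Finset.Ioc 0 N, wt P₁ P₂ n / n ≤
      ∏ p ∈ (N + 1).primesBelow, ∑' n : ℕ, wt P₁ P₂ (p ^ n) / ((p ^ n : ℕ) : ℝ) := by
    have hsub : ∀ n ∈ Finset.Ioc 0 N, n ∈ (N + 1).smoothNumbers := by
      intro n hn
      rw [Finset.mem_Ioc] at hn
      exact Nat.mem_smoothNumbers_of_lt hn.1 (by omega)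
    rw [← Finset.sum_subtype_of_mem (p := fun n => n ∈ (N+1).smoothNumbers)
      (fun n : ℕ => wt P₁ P₂ n / (n:ℝ)) hsub]
    exact sum_le_hasSum _ (fun n _ => div_nonneg (wt_nonneg _ _ _) (by positivity)) key
  refine h1.trans ?_
  rw [Real.exp_sum]
  refine Finset.prod_le_prod (fun p _ => tsum_nonneg fun n =>
    div_nonneg (wt_nonneg _ _ _) (by positivity)) fun p hp => ?_
  rw [(hasSum_wt P₁ P₂ (Nat.prime_of_mem_primesBelow hp)).tsum_eq, add_comm]
  exact Real.add_one_le_exp _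

lemma wt_prime (P₁ P₂ : Set ℕ) (hdisj : Disjoint P₁ P₂) {p : ℕ} (hp : p.Prime) :
    wt P₁ P₂ p = 1 + 2 * (if p ∈ P₂ then 1 else 0) - (if p ∈ P₁ then 1 else 0) := by
  rw [wt_apply _ _ hp.ne_zero, hp.primeFactors, Finset.filter_singleton, Finset.filter_singleton]
  by_cases h1 : p ∈ P₁
  · have h2 : p ∉ P₂ := fun h2 => Set.disjoint_left.1 hdisj h1 h2
    simp [h1, h2]
  · by_cases h2 : p ∈ P₂ <;> simp [h1, h2]; norm_num

lemma sum_wt_prime (P₁ P₂ : Set ℕ) (hP₁ : ∀ p ∈ P₁, Nat.Prime p) (hP₂ : ∀ p ∈ P₂, Nat.Prime p)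
    (hdisj : Disjoint P₁ P₂) : ∃ K : ℝ, ∀ N : ℕ,
    ∑ p ∈ (Finset.range (N + 1)).filter Nat.Prime, wt P₁ P₂ p / ((p:ℝ) - 1) ≤
    ∑ p ∈ (Finset.range (N + 1)).filter Nat.Prime, (1:ℝ) / p +
    2 * ∑ p ∈ (Finset.range (N + 1)).filter (fun p => p ∈ P₂), (1:ℝ) / p -
    ∑ p ∈ (Finset.range (N + 1)).filter (fun p => p ∈ P₁), (1:ℝ) / p + K := by
  have hs : Summable (fun n : ℕ => 6 * ((1:ℝ) / (n:ℝ) ^ 2)) :=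
    (Real.summable_one_div_nat_pow.2 (by norm_num)).mul_left 6
  refine ⟨∑' n : ℕ, 6 * ((1:ℝ) / (n:ℝ) ^ 2), fun N => ?_⟩
  have hK := hs.sum_le_tsum ((Finset.range (N + 1)).filter Nat.Prime) (fun n _ => by positivity)
  have e : ∀ P : Set ℕ, (∀ p ∈ P, Nat.Prime p) →
      ∑ p ∈ (Finset.range (N + 1)).filter (fun p => p ∈ P), (1:ℝ) / p =
      ∑ p ∈ (Finset.range (N + 1)).filter Nat.Prime, (if p ∈ P then 1 else 0) * ((1:ℝ) / p) := by
    intro P hP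
    simp only [ite_mul, one_mul, zero_mul]
    rw [← Finset.sum_filter, Finset.filter_filter]
    refine Finset.sum_congr ?_ fun _ _ => rfl
    ext p
    simp only [Finset.mem_filter]
    exact ⟨fun h => ⟨h.1, hP p h.2, h.2⟩, fun h => ⟨h.1, h.2.2⟩⟩
  rw [e P₁ hP₁, e P₂ hP₂]
  refine le_trans ?_ (add_le_add le_rfl hK)
  rw [Finset.mul_sum, ← Finset.sum_add_distrib, ← Finset.sum_sub_distrib, ← Finset.sum_add_distrib]
  refine Finset.sum_le_sum fun p hp => ?_
  have hp := (Finset.mem_filter.1 hp).2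
  have hp2 : (2:ℝ) ≤ p := by exact_mod_cast hp.two_le
  have h3 : wt P₁ P₂ p ≤ 3 := by
    have := wt_mul_prime_pow_le P₁ P₂ one_ne_zero hp one_ne_zero
    simpa [wt_one] using this
  have h4 : wt P₁ P₂ p / ((p:ℝ) - 1) ≤ wt P₁ P₂ p * (1 / p) + 6 * (1 / (p:ℝ)^2) := by
    have h5 : wt P₁ P₂ p / ((p:ℝ) - 1) = wt P₁ P₂ p * (1 / p) + wt P₁ P₂ p * (1 / (p * (p - 1))) := by
      have : (p:ℝ) - 1 ≠ 0 := by linarith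
      field_simp
      ring
    have h6 : wt P₁ P₂ p * (1 / ((p:ℝ) * (p - 1))) ≤ 3 * (2 * (1 / (p:ℝ)^2)) := by
      have hpos : (0:ℝ) < p * (p - 1) := by nlinarith
      refine mul_le_mul h3 ?_ (by positivity) (by norm_num)
      rw [mul_one_div, div_le_div_iff₀ hpos (by positivity)]
      nlinarith
    rw [h5]; linarith
  refine h4.trans (le_of_eq ?_)
  rw [wt_prime P₁ P₂ hdisj hp]
  ring

/-- Large-deviation bound: let `P₁, P₂` be disjoint sets of primes with
`∑_{p ∈ P₁, p ≤ z} 1/p ~ (2/3) log log z` and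
`∑_{p ∈ P₂, p ≤ z} 1/p ~ (1/3) log log z`. Then for every `η > 0` there is
`ε > 0` such that the number of `d ≤ N` with no prime factor in `P₁` and at
least `(1-ε) log log N` distinct prime factors in `P₂` is
`O(N / (log N)^(log 3 - η))`. -/
theorem large_deviation_prime_factors (P₁ P₂ : Set ℕ)
    (hP₁ : ∀ p ∈ P₁, Nat.Prime p) (hP₂ : ∀ p ∈ P₂, Nat.Prime p)
    (hdisj : Disjoint P₁ P₂)
    (hd₁ : Tendsto (fun z : ℕ =>
      (∑ p ∈ (Finset.range (z + 1)).filter (fun p => p ∈ P₁), (1 : ℝ) / p) /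
        Real.log (Real.log z)) atTop (nhds (2 / 3)))
    (hd₂ : Tendsto (fun z : ℕ =>
      (∑ p ∈ (Finset.range (z + 1)).filter (fun p => p ∈ P₂), (1 : ℝ) / p) /
        Real.log (Real.log z)) atTop (nhds (1 / 3))) :
    ∀ η : ℝ, 0 < η → ∃ ε : ℝ, 0 < ε ∧ ∃ C : ℝ, 0 < C ∧
      ∀ᶠ N : ℕ in atTop,
        (((Finset.Icc 1 N).filter (fun d =>
            (d.primeFactors.filter (fun p => p ∈ P₁)).card = 0 ∧
            (1 - ε) * Real.log (Real.log N) ≤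
              ((d.primeFactors.filter (fun p => p ∈ P₂)).card : ℝ))).card : ℝ) ≤
          C * (N : ℝ) / (Real.log N) ^ (Real.log 3 - η) := by
  intro η hη
  have hl3 : 0 < Real.log 3 := Real.log_pos (by norm_num)
  obtain ⟨K₁, hK₁⟩ := primes_upper (Real.log (1 + η / 8)) (Real.log_pos (by linarith))
  obtain ⟨K₂, hK₂⟩ := sum_wt_prime P₁ P₂ hP₁ hP₂ hdisj
  rw [Real.exp_log (by positivity)] at hK₁
  have hlog : Tendsto (fun z : ℕ => Real.log z) atTop atTop :=
    Real.tendsto_log_atTop.comp tendsto_natCast_atTop_atTop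
  have hll : Tendsto (fun z : ℕ => Real.log (Real.log z)) atTop atTop :=
    Real.tendsto_log_atTop.comp hlog
  have hl4 : 0 < Real.log 4 := Real.log_pos (by norm_num)
  refine ⟨η / (2 * Real.log 3), by positivity,
    (3 * (Real.log 4 + 4) + 1) * Real.exp (K₁ + K₂), by positivity, ?_⟩
  filter_upwards [hK₁, hlog.eventually_gt_atTop 0, hll.eventually_gt_atTop 0,
    hd₁.eventually_const_lt (show 2 / 3 - η / 8 < (2:ℝ) / 3 by linarith),
    hd₂.eventually_lt_const (show (1:ℝ) / 3 < 1 / 3 + η / 8 by linarith)] with N h1 h2 h3 h4 h5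
  rw [lt_div_iff₀ h3] at h4
  rw [div_lt_iff₀ h3] at h5
  set ε := η / (2 * Real.log 3) with hε
  set LL := Real.log (Real.log N) with hLL
  have h6 := hK₂ N
  have h7 : ∑ p ∈ (Finset.range (N + 1)).filter Nat.Prime, wt P₁ P₂ p / ((p:ℝ) - 1) ≤
      LL + η / 2 * LL + (K₁ + K₂) := by
    linarith
  have h8 := wt_sum_le P₁ P₂ N
  have h9 : (∑ n ∈ Finset.Ioc 0 N, wt P₁ P₂ n) * Real.log N ≤
      (3 * (Real.log 4 + 4) + 1) * N * Real.exp (LL + η / 2 * LL + (K₁ + K₂)) := by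
    refine h8.trans ?_
    gcongr
    exact (wt_div_sum_le P₁ P₂ N).trans (Real.exp_le_exp.2 h7)
  set A := (Finset.Icc 1 N).filter (fun d =>
            (d.primeFactors.filter (fun p => p ∈ P₁)).card = 0 ∧
            (1 - ε) * LL ≤ ((d.primeFactors.filter (fun p => p ∈ P₂)).card : ℝ)) with hA
  have h10 : (A.card : ℝ) * Real.exp (Real.log 3 * ((1 - ε) * LL)) ≤
      ∑ n ∈ Finset.Ioc 0 N, wt P₁ P₂ n := by
    rw [← nsmul_eq_mul]
    refine (Finset.card_nsmul_le_sum A (fun n => wt P₁ P₂ n) _ ?_).trans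
      (Finset.sum_le_sum_of_subset_of_nonneg ?_ fun n _ _ => wt_nonneg _ _ _)
    · intro d hd
      simp only [hA, Finset.mem_filter, Finset.mem_Icc] at hd
      obtain ⟨⟨hd1, -⟩, hd2, hd3⟩ := hd
      rw [wt_apply _ _ (by omega), if_pos hd2, ← Real.rpow_natCast,
        Real.rpow_def_of_pos (by norm_num)]
      exact Real.exp_le_exp.2 (mul_le_mul_of_nonneg_left hd3 hl3.le)
    · intro d hd
      simp only [hA, Finset.mem_filter, Finset.mem_Icc] at hd
      rw [Finset.mem_Ioc]; omega
  have hexp : Real.log N = Real.exp LL := (Real.exp_log h2).symm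
  rw [le_div_iff₀ (Real.rpow_pos_of_pos h2 _), Real.rpow_def_of_pos h2, ← hLL]
  have h11 := (mul_le_mul_of_nonneg_right h10 h2.le).trans h9
  rw [hexp, mul_assoc, ← Real.exp_add] at h11
  have h12 : Real.log 3 * ε = η / 2 := by rw [hε]; field_simp
  have h13 := mul_le_mul_of_nonneg_right h11 (Real.exp_pos (-(LL + η / 2 * LL))).le
  rw [mul_assoc, mul_assoc, ← Real.exp_add, ← Real.exp_add] at h13
  have e1 : Real.log 3 * ((1 - ε) * LL) + LL + -(LL + η / 2 * LL) = LL * (Real.log 3 - η) := by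
    linear_combination (-LL) * h12
  have e2 : LL + η / 2 * LL + (K₁ + K₂) + -(LL + η / 2 * LL) = K₁ + K₂ := by ring
  rw [e1, e2] at h13
  linarith
end
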